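/- Let A be an n×n real matrix with maximum geometric multiplicity k_max and let l ≥ k_max. Then the MACP optimum of A is less than or equal to the l-MSCP optimum of A, i.e., min{|S| : S ⊆ {1,…,n}, (A, I_S) is controllable} ≤ min{‖B‖₀ : B ∈ ℝ^{n×l}, (A,B) is controllable}. -/

import Mathlib

open Matrix

noncomputable section

/-- The controllability matrix `[B, AB, A²B, …, A^{n-1}B]`, as an `n × (n·l)` matrix. -/
def ctrbMat {R : Type} [CommRing R] {n l : ℕ} (A : Matrix (Fin n) (Fin n) R)
    (B : Matrix (Fin n) (Fin l) R) : Matrix (Fin n) (Fin n × Fin l) R :=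
  Matrix.of fun i jk => (A ^ (jk.1 : ℕ) * B) i jk.2

/-- `(A, B)` is controllable iff the controllability matrix has rank `n`. -/
def Controllable {R : Type} [CommRing R] {n l : ℕ} (A : Matrix (Fin n) (Fin n) R)
    (B : Matrix (Fin n) (Fin l) R) : Prop :=
  (ctrbMat A B).rank = n

/-- The columns of a matrix, as vectors. -/
def matCols {R : Type} [CommRing R] {n k : ℕ} (X : Matrix (Fin n) (Fin k) R) :
    Fin k → (Fin n → R) := fun j i => X i j

/-- `X` is an `n × k` matrix whose columns are a basis of the λ-eigenspace of `Aᵀ`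
(equivalently, its columns are `k` linearly independent left eigenvectors of `A`
for `μ`, spanning the whole left eigenspace; in particular `k` is the geometric
multiplicity of `μ`). -/
def IsLeftEigenbasis {n k : ℕ} (A : Matrix (Fin n) (Fin n) ℂ) (μ : ℂ)
    (X : Matrix (Fin n) (Fin k) ℂ) : Prop :=
  LinearIndependent ℂ (matCols X) ∧
  (∀ j, A.transpose.mulVec (matCols X j) = μ • matCols X j) ∧
  (∀ v : Fin n → ℂ, A.transpose.mulVec v = μ • v →
      v ∈ Submodule.span ℂ (Set.range (matCols X)))

/-- The submatrix of `M` consisting of the columns indexed by `S`. -/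
def colSub {R : Type} [CommRing R] {m n : ℕ} (M : Matrix (Fin m) (Fin n) R)
    (S : Finset (Fin n)) : Matrix (Fin m) {x // x ∈ S} R :=
  M.submatrix id (fun j => (j : Fin n))

/-- `H = {J ⊆ {1,…,n} : |J| = k and the k×k submatrix of Xᵀ formed by the columns
indexed by J is invertible}` (invertibility of the square submatrix is expressed
as full rank `k`). -/
def Hset {n k : ℕ} (X : Matrix (Fin n) (Fin k) ℂ) : Set (Finset (Fin n)) :=
  {J | J.card = k ∧ (colSub X.transpose J).rank = k}

/-- The diagonal 0/1 matrix `I_S` selecting the states in `S`. -/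
def diagSel {n : ℕ} (S : Finset (Fin n)) : Matrix (Fin n) (Fin n) ℝ :=
  Matrix.diagonal (fun j => if j ∈ S then (1 : ℝ) else 0)

/-- `‖B‖₀`, the number of nonzero entries of `B`. -/
def sparsity {n l : ℕ} (B : Matrix (Fin n) (Fin l) ℝ) : ℕ :=
  (Finset.univ.filter fun jc : Fin n × Fin l => B jc.1 jc.2 ≠ 0).card

/-- The MACP optimum: the minimal cardinality of a set `S` of actuated states
such that `(A, I_S)` is controllable. -/
def MACPopt {n : ℕ} (A : Matrix (Fin n) (Fin n) ℝ) : ℕ :=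
  sInf {m | ∃ S : Finset (Fin n), Controllable A (diagSel S) ∧ S.card = m}

/-- The `l`-MSCP optimum: the minimal number of nonzero entries of an `n × l`
real matrix `B` such that `(A, B)` is controllable. -/
def MSCPopt {n : ℕ} (A : Matrix (Fin n) (Fin n) ℝ) (l : ℕ) : ℕ :=
  sInf {m | ∃ B : Matrix (Fin n) (Fin l) ℝ, Controllable A B ∧ sparsity B = m}

/-- Over a field, `(A, B)` is controllable iff no nonzero row vector annihilates every
block `A ^ k * B` of the controllability matrix. -/
theorem controllable_iff_vecMul {K : Type} [Field K] {n l : ℕ} (A : Matrix (Fin n) (Fin n) K)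
    (B : Matrix (Fin n) (Fin l) K) :
    Controllable A B ↔ ∀ v : Fin n → K, (∀ k < n, v ᵥ* (A ^ k * B) = 0) → v = 0 := by
  have hker : ∀ v : Fin n → K,
      v ᵥ* ctrbMat A B = 0 ↔ ∀ k < n, v ᵥ* (A ^ k * B) = 0 := by
    intro v
    constructor
    · intro h k hk
      funext j
      exact congrFun h (⟨k, hk⟩, j)
    · intro h
      funext ⟨k, j⟩
      exact congrFun (h k k.2) j
  have hrank : Controllable A B ↔ Function.Injective (ctrbMat A B).vecMulLinear := by
    rw [coe_vecMulLinear, vecMul_injective_iff, linearIndependent_iff_card_eq_finrank_span,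
      Set.finrank, ← rank_eq_finrank_span_row, Fintype.card_fin]
    exact eq_comm
  rw [hrank, injective_iff_map_eq_zero]
  exact forall_congr' fun v => imp_congr_left (by simpa using hker v)

/-- By Cayley–Hamilton, the powers of `A` below `n` determine the vanishing of all
`v ᵥ* (A ^ k * B)`. -/
theorem vecMul_pow_mul_eq_zero {R : Type} [CommRing R] {n l : ℕ} {A : Matrix (Fin n) (Fin n) R}
    {B : Matrix (Fin n) (Fin l) R} {v : Fin n → R} (h : ∀ k < n, v ᵥ* (A ^ k * B) = 0) (k : ℕ) :
    v ᵥ* (A ^ k * B) = 0 := by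
  nontriviality R
  rw [pow_eq_aeval_mod_charpoly, Polynomial.aeval_eq_sum_range, Matrix.sum_mul, vecMul_sum]
  refine Finset.sum_eq_zero fun i _ => ?_
  rw [Matrix.smul_mul, vecMul_smul]
  by_cases hi : i < n
  · rw [h i hi, smul_zero]
  · rw [Polynomial.coeff_eq_zero_of_degree_lt, zero_smul]
    refine (Polynomial.degree_modByMonic_lt _ A.charpoly_monic).trans_le ?_
    rw [charpoly_degree_eq_dim, Fintype.card_fin]
    exact_mod_cast not_lt.mp hi

/-- The Popov–Belevitch–Hautus eigenvector test for controllability. -/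
theorem controllable_of_eigenvector_test {n l : ℕ} (A : Matrix (Fin n) (Fin n) ℝ)
    (B : Matrix (Fin n) (Fin l) ℝ)
    (h : ∀ (μ : ℂ) (w : Fin n → ℂ), w ᵥ* A.map Complex.ofReal = μ • w →
      w ᵥ* B.map Complex.ofReal = 0 → w = 0) :
    Controllable A B := by
  rw [controllable_iff_vecMul]
  intro v hv
  by_contra hv0
  set A' := A.map Complex.ofReal
  set B' := B.map Complex.ofReal
  let W : Submodule ℂ (Fin n → ℂ) := ⨅ k : ℕ, LinearMap.ker (A' ^ k * B').vecMulLinear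
  have hW : ∀ w, w ∈ W ↔ ∀ k : ℕ, w ᵥ* (A' ^ k * B') = 0 := by simp [W]
  have hinv : ∀ w ∈ W, A'.vecMulLinear w ∈ W := by
    intro w hw
    rw [hW] at hw ⊢
    intro k
    rw [vecMulLinear_apply, vecMul_vecMul, ← Matrix.mul_assoc, ← pow_succ']
    exact hw (k + 1)
  have hvW : (fun i => (v i : ℂ)) ∈ W := by
    rw [hW]
    intro k
    have hmap : A' ^ k * B' = (A ^ k * B).map Complex.ofRealHom := by
      rw [Matrix.map_mul, Matrix.map_pow]
      rfl
    rw [hmap]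
    funext j
    have := RingHom.map_vecMul Complex.ofRealHom (A ^ k * B) v j
    rw [vecMul_pow_mul_eq_zero hv k] at this
    simpa [Function.comp_def] using this.symm
  have : Nontrivial W := by
    refine ⟨⟨⟨_, hvW⟩, 0, fun h0 => hv0 ?_⟩⟩
    funext i
    simpa using congrFun (congrArg Subtype.val h0) i
  obtain ⟨μ, hμ⟩ := Module.End.exists_eigenvalue (A'.vecMulLinear.restrict hinv)
  obtain ⟨w, hw⟩ := hμ.exists_hasEigenvector
  refine hw.2 (Subtype.ext (h μ w (congrArg Subtype.val hw.apply_eq_smul) ?_))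
  simpa using (hW w).1 w.2 0

/-- Finitely many nonzero complex vectors can be simultaneously detected by one real vector. -/
theorem exists_real_dotProduct_ne_zero {ι : Type*} [Finite ι] {n : ℕ} (w : ι → Fin n → ℂ) :
    ∃ b : Fin n → ℝ, ∀ i, w i ≠ 0 → w i ⬝ᵥ (fun j => (b j : ℂ)) ≠ 0 := by
  let f : ι → (Fin n → ℝ) →ₗ[ℝ] ℂ := fun i => Fintype.linearCombination ℝ (w i)
  have hf : ∀ i b, f i b = w i ⬝ᵥ (fun j => (b j : ℂ)) := by
    intro i b
    simp [f, Fintype.linearCombination_apply, dotProduct, mul_comm]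
  obtain ⟨b, hb⟩ := Submodule.exists_forall_notMem_of_forall_ne_top
    (fun i : {i // w i ≠ 0} => LinearMap.ker (f i)) fun i htop => i.2 <| by
      funext j
      have : f i (Pi.single j 1) = 0 := LinearMap.congr_fun (LinearMap.ker_eq_top.1 htop) _
      simpa [f] using this
  exact ⟨b, fun i hi => hf i b ▸ hb ⟨i, hi⟩⟩

/-- A finite family of subspaces of `ℂⁿ` of dimension at most `l` admits a common real
`n × l` matrix whose left kernel meets each of them trivially. -/
theorem exists_real_matrix_vecMul_injOn {ι : Type*} [Finite ι] {n : ℕ} (l : ℕ)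
    (W : ι → Submodule ℂ (Fin n → ℂ)) (hW : ∀ i, Module.finrank ℂ (W i) ≤ l) :
    ∃ B : Matrix (Fin n) (Fin l) ℝ,
      ∀ i, ∀ w ∈ W i, w ᵥ* B.map Complex.ofReal = 0 → w = 0 := by
  induction l generalizing W with
  | zero =>
    refine ⟨0, fun i w hw _ => ?_⟩
    rwa [Submodule.finrank_eq_zero.1 (Nat.le_zero.1 (hW i)), Submodule.mem_bot] at hw
  | succ l ih =>
    have hex : ∀ i, ∃ w ∈ W i, W i ≠ ⊥ → w ≠ 0 := by
      intro i
      by_cases hi : W i = ⊥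
      · exact ⟨0, zero_mem _, fun h => absurd hi h⟩
      · obtain ⟨w, hw, hw0⟩ := Submodule.exists_mem_ne_zero_of_ne_bot hi
        exact ⟨w, hw, fun _ => hw0⟩
    choose w hwW hw0 using hex
    obtain ⟨b, hb⟩ := exists_real_dotProduct_ne_zero w
    let f : (Fin n → ℂ) →ₗ[ℂ] ℂ := dotProductBilin ℂ ℂ |>.flip fun j => (b j : ℂ)
    obtain ⟨B, hB⟩ := ih (fun i => W i ⊓ LinearMap.ker f) fun i => by
      by_cases hi : W i = ⊥
      · have hbot : W i ⊓ LinearMap.ker f = ⊥ := by rw [hi, bot_inf_eq]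
        exact (Submodule.finrank_eq_zero.2 hbot).trans_le (Nat.zero_le l)
      · have hlt : W i ⊓ LinearMap.ker f < W i :=
          lt_of_le_of_ne inf_le_left fun heq =>
            hb i (hw0 i hi) (inf_eq_left.1 heq (hwW i))
        have := Submodule.finrank_lt_finrank_of_lt hlt
        have := hW i
        omega
    refine ⟨Matrix.of fun i => Fin.cons (b i) (B i), fun i v hv hv0 => hB i v ⟨hv, ?_⟩ ?_⟩
    · exact congrFun hv0 0
    · funext j
      exact congrFun hv0 j.succ

theorem finrank_ker_vecMulLinear {K : Type*} [Field K] {n : ℕ} (M : Matrix (Fin n) (Fin n) K) :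
    Module.finrank K (LinearMap.ker M.vecMulLinear) = n - M.rank := by
  have h := LinearMap.finrank_range_add_finrank_ker M.vecMulLinear
  rw [← rank_transpose, Matrix.rank, mulVecLin_transpose]
  rw [Module.finrank_fin_fun] at h
  omega

/-- `l` inputs suffice for controllability when all geometric multiplicities are at most `l`. -/
theorem exists_controllable {n l : ℕ} (A : Matrix (Fin n) (Fin n) ℝ)
    (hl : ∀ μ ∈ spectrum ℂ (A.map Complex.ofReal),
      n - (μ • (1 : Matrix (Fin n) (Fin n) ℂ) - A.map Complex.ofReal).rank ≤ l) :
    ∃ B : Matrix (Fin n) (Fin l) ℝ, Controllable A B := by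
  obtain ⟨B, hB⟩ := exists_real_matrix_vecMul_injOn l
    (fun μ : spectrum ℂ (A.map Complex.ofReal) =>
      LinearMap.ker ((μ : ℂ) • (1 : Matrix (Fin n) (Fin n) ℂ) - A.map Complex.ofReal).vecMulLinear)
    fun μ => (finrank_ker_vecMulLinear _).trans_le (hl μ μ.2)
  refine ⟨B, controllable_of_eigenvector_test A B fun μ w hw hwB => ?_⟩
  have hker : w ᵥ* (μ • (1 : Matrix (Fin n) (Fin n) ℂ) - A.map Complex.ofReal) = 0 := by
    rw [vecMul_sub, vecMul_smul, vecMul_one, hw, sub_self]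
  by_cases hμ : μ ∈ spectrum ℂ (A.map Complex.ofReal)
  · exact hB ⟨μ, hμ⟩ w hker hwB
  · rw [spectrum.notMem_iff, Algebra.algebraMap_eq_smul_one] at hμ
    exact vecMul_injective_of_isUnit hμ (hker.trans (zero_vecMul _).symm)

/-- Actuating the states met by the nonzero entries of `B` preserves controllability. -/
theorem exists_diagSel_controllable {n l : ℕ} {A : Matrix (Fin n) (Fin n) ℝ}
    {B : Matrix (Fin n) (Fin l) ℝ} (h : Controllable A B) :
    ∃ S : Finset (Fin n), Controllable A (diagSel S) ∧ S.card ≤ sparsity B := by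
  classical
  let S := (Finset.univ.filter fun jc : Fin n × Fin l => B jc.1 jc.2 ≠ 0).image Prod.fst
  refine ⟨S, ?_, Finset.card_image_le⟩
  have hS : diagSel S * B = B := by
    ext i j
    rw [diagSel, diagonal_mul]
    by_cases hij : B i j = 0
    · rw [hij, mul_zero]
    · rw [if_pos (Finset.mem_image.2 ⟨(i, j), by simpa using hij, rfl⟩), one_mul]
  rw [controllable_iff_vecMul] at h ⊢
  intro v hv
  refine h v fun k hk => ?_
  rw [← hS, ← Matrix.mul_assoc, ← vecMul_vecMul, hv k hk, zero_vecMul]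

theorem statement_18 {n l : ℕ} (A : Matrix (Fin n) (Fin n) ℝ)
    (hl : ∀ μ ∈ spectrum ℂ (A.map Complex.ofReal),
      n - (μ • (1 : Matrix (Fin n) (Fin n) ℂ) - A.map Complex.ofReal).rank ≤ l) :
    MACPopt A ≤ MSCPopt A l := by
  obtain ⟨B₀, hB₀⟩ := exists_controllable A hl
  obtain ⟨B, hB, hBl⟩ : MSCPopt A l ∈
      {m | ∃ B : Matrix (Fin n) (Fin l) ℝ, Controllable A B ∧ sparsity B = m} :=
    Nat.sInf_mem ⟨_, B₀, hB₀, rfl⟩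
  obtain ⟨S, hS, hcard⟩ := exists_diagSel_controllable hB
  exact le_trans (b := S.card) (Nat.sInf_le ⟨S, hS, rfl⟩) (hcard.trans_eq hBl)
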